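/- Let K be a field of characteristic zero, let W be a K-vector space of dimension 2, and let GL(W) act on U = End(W)^{⊕3} (triples of endomorphisms) by simultaneous conjugation g·(M₁,M₂,M₃) = (gM₁g⁻¹, gM₂g⁻¹, gM₃g⁻¹). Then the Hilbert series of the invariant ring K[U]^{GL(W)} equals (1 − x + x²)/((1−x²)⁵(1−x)⁴). -/

import Mathlib

open PowerSeries

/-- The space of `Γ`-invariant homogeneous polynomial functions of degree `n` on `U`
(for the action `act` of `Γ` on `U`): functions `U → K` which are restrictions to the
diagonal of an `n`-multilinear form (over a field of characteristic zero this is exactly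
the degree-`n` homogeneous polynomial functions) and which are invariant under `act`.
This is the `n`-th homogeneous component `(K[U]^Γ)ₙ` of the invariant ring. -/
def invariantPolynomials (K : Type) [Field K] {U Γ : Type} [AddCommGroup U] [Module K U]
    (act : Γ → U → U) (n : ℕ) : Submodule K (U → K) where
  carrier := {F | (∃ m : MultilinearMap K (fun _ : Fin n => U) K, ∀ u, F u = m fun _ => u) ∧
    ∀ γ u, F (act γ u) = F u}
  add_mem' := by
    rintro F G ⟨⟨mF, hF⟩, hFi⟩ ⟨⟨mG, hG⟩, hGi⟩
    refine ⟨⟨mF + mG, fun u => ?_⟩, fun γ u => ?_⟩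
    · simp [hF, hG]
    · simp [Pi.add_apply, hFi γ u, hGi γ u]
  zero_mem' := by
    refine ⟨⟨0, fun u => ?_⟩, fun γ u => rfl⟩
    simp
  smul_mem' := by
    rintro c F ⟨⟨mF, hF⟩, hFi⟩
    refine ⟨⟨c • mF, fun u => ?_⟩, fun γ u => ?_⟩
    · simp [hF]
    · simp [Pi.smul_apply, hFi γ u]

/-- The simultaneous conjugation action of `GL(W)` on `End(W)^{⊕k}`:
`g · (M₁, …, M_k) = (g M₁ g⁻¹, …, g M_k g⁻¹)`. -/
def conjAction (K : Type) [Field K] (W : Type) [AddCommGroup W] [Module K W] (k : ℕ) :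
    (W ≃ₗ[K] W) → (Fin k → W →ₗ[K] W) → (Fin k → W →ₗ[K] W) :=
  fun g M i => g.toLinearMap ∘ₗ M i ∘ₗ g.symm.toLinearMap

section SlTwo

variable {K M : Type*} [Field K] [AddCommGroup M] [Module K M]
  {E F : M →ₗ[K] M} {V : ℤ → Submodule K M}

lemma pow_raise_mem (hE : ∀ k, ∀ v ∈ V k, E v ∈ V (k + 1)) {k : ℤ} {v : M} (hv : v ∈ V k) (m : ℕ) :
    (E ^ m) v ∈ V (k + m) := by
  induction m with
  | zero => simpa using hv
  | succ m ih =>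
    rw [pow_succ', Module.End.mul_apply]
    have := hE _ _ ih
    push_cast
    rwa [← add_assoc]

lemma pow_raise_lower (hE : ∀ k, ∀ v ∈ V k, E v ∈ V (k + 1))
    (hEF : ∀ k : ℤ, ∀ v ∈ V k, E (F v) = F (E v) + (2 * k : K) • v)
    {k : ℤ} {v : M} (hv : v ∈ V k) (m : ℕ) :
    (E ^ (m + 1)) (F v) = F ((E ^ (m + 1)) v) + ((m + 1) * (2 * k + m) : K) • (E ^ m) v := by
  induction m with
  | zero => simpa using hEF k v hv
  | succ m ih =>
    rw [pow_succ', Module.End.mul_apply, ih, map_add, map_smul,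
      hEF _ _ (pow_raise_mem hE hv (m + 1)), Module.End.mul_apply E (E ^ (m + 1)),
      ← Module.End.mul_apply E (E ^ m), ← pow_succ', add_assoc, ← add_smul]
    congr 2
    push_cast
    ring

lemma exists_raise_eq [CharZero K] (hE : ∀ k, ∀ v ∈ V k, E v ∈ V (k + 1))
    (hF : ∀ k, ∀ v ∈ V k, F v ∈ V (k - 1))
    (hEF : ∀ k : ℤ, ∀ v ∈ V k, E (F v) = F (E v) + (2 * k : K) • v)
    {k : ℤ} (hk : 0 < k) (m : ℕ) {v : M} (hv : v ∈ V k) (hm : (E ^ m) v = 0) :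
    ∃ u ∈ V (k - 1), E u = v := by
  induction m generalizing v with
  | zero => exact ⟨0, zero_mem _, by simpa using hm.symm⟩
  | succ m ih =>
    set c : K := (m + 1) * (2 * k + m) with hc
    have hc0 : c ≠ 0 := by
      have : ((m + 1) * (2 * k + m) : ℤ) ≠ 0 := by positivity
      rw [hc]
      exact_mod_cast this
    have hEFv : E (F v) ∈ V k := by simpa using hE _ _ (hF _ _ hv)
    obtain ⟨u, hu, hu'⟩ := ih (v := E (F v) - c • v) (sub_mem hEFv ((V k).smul_mem c hv)) (by
      rw [map_sub, map_smul, ← Module.End.mul_apply, ← pow_succ, pow_raise_lower hE hEF hv, hm,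
        map_zero, zero_add, ← hc, sub_self])
    refine ⟨c⁻¹ • (F v - u), Submodule.smul_mem _ _ (sub_mem (hF _ _ hv) hu), ?_⟩
    rw [map_smul, map_sub, hu', sub_sub_cancel, inv_smul_smul₀ hc0]

lemma eq_zero_of_lower_eq_zero [CharZero K] (hE : ∀ k, ∀ v ∈ V k, E v ∈ V (k + 1))
    (hEF : ∀ k : ℤ, ∀ v ∈ V k, E (F v) = F (E v) + (2 * k : K) • v)
    {k : ℤ} (hk : 0 < k) (m : ℕ) {v : M} (hv : v ∈ V k) (hm : (E ^ m) v = 0) (hFv : F v = 0) :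
    v = 0 := by
  induction m with
  | zero => simpa using hm
  | succ m ih =>
    have h := pow_raise_lower hE hEF hv m
    rw [hFv, hm, map_zero, map_zero, zero_add] at h
    have hc0 : ((m + 1) * (2 * k + m) : K) ≠ 0 := by
      have : ((m + 1) * (2 * k + m) : ℤ) ≠ 0 := by positivity
      exact_mod_cast this
    exact ih ((smul_eq_zero.1 h.symm).resolve_left hc0)

end SlTwo

section Series

lemma cast_choose_two_add (j : ℕ) : ((2 + j).choose 2 : ℚ) = (j + 1) * (j + 2) / 2 := by
  have h := Nat.descFactorial_eq_factorial_mul_choose (j + 2) 2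
  simp [Nat.descFactorial, Nat.factorial] at h
  rw [eq_div_iff two_ne_zero, add_comm 2 j, mul_comm]
  exact_mod_cast h.symm

lemma cast_choose_three_add (j : ℕ) :
    ((3 + j).choose 3 : ℚ) = (j + 1) * ((j + 2) * (j + 3)) / 6 := by
  have h := Nat.descFactorial_eq_factorial_mul_choose (j + 3) 3
  simp [Nat.descFactorial, Nat.factorial] at h
  rw [eq_div_iff (by norm_num), add_comm 3 j, mul_comm]
  exact_mod_cast h.symm

lemma cast_choose_four_add (j : ℕ) :
    ((4 + j).choose 4 : ℚ) = (j + 1) * ((j + 2) * ((j + 3) * (j + 4))) / 24 := by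
  have h := Nat.descFactorial_eq_factorial_mul_choose (j + 4) 4
  simp [Nat.descFactorial, Nat.factorial] at h
  rw [eq_div_iff (by norm_num), add_comm 4 j, mul_comm]
  exact_mod_cast h.symm

lemma choose_two_mul_self (j : ℕ) :
    ((2 + j).choose 2 * (2 + j).choose 2 : ℤ) =
      6 * (4 + j).choose 4 - 6 * (3 + j).choose 3 + (2 + j).choose 2 := by
  have : ((2 + j).choose 2 * (2 + j).choose 2 : ℚ) =
      6 * (4 + j).choose 4 - 6 * (3 + j).choose 3 + (2 + j).choose 2 := by
    rw [cast_choose_two_add, cast_choose_three_add, cast_choose_four_add]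
    ring
  exact_mod_cast this

lemma choose_two_mul_succ (j : ℕ) :
    ((2 + j).choose 2 * (2 + (j + 1)).choose 2 : ℤ) =
      6 * (4 + j).choose 4 - 3 * (3 + j).choose 3 := by
  have : ((2 + j).choose 2 * (2 + (j + 1)).choose 2 : ℚ) =
      6 * (4 + j).choose 4 - 3 * (3 + j).choose 3 := by
    rw [cast_choose_two_add, cast_choose_two_add, cast_choose_three_add, cast_choose_four_add]
    push_cast
    ring
  exact_mod_cast this

lemma mk_choose_two_mul_self :
    (mk fun j => ((2 + j).choose 2 * (2 + j).choose 2 : ℤ)) * (1 - X) ^ 5 = 1 + 4 * X + X ^ 2 := by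
  have h2 := mk_add_choose_mul_one_sub_pow_eq_one ℤ 2
  have h3 := mk_add_choose_mul_one_sub_pow_eq_one ℤ 3
  have h4 := mk_add_choose_mul_one_sub_pow_eq_one ℤ 4
  have h : (mk fun j => ((2 + j).choose 2 * (2 + j).choose 2 : ℤ)) =
      6 * (mk fun j => ((4 + j).choose 4 : ℤ)) - 6 * (mk fun j => ((3 + j).choose 3 : ℤ)) +
        mk fun j => ((2 + j).choose 2 : ℤ) := by
    ext j
    have h6 (f : ℤ⟦X⟧) : coeff j (6 * f) = 6 * coeff j f := coeff_C_mul j f 6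
    simp [h6, choose_two_mul_self]
  rw [h]
  linear_combination 6 * h4 - 6 * (1 - X) * h3 + (1 - X) ^ 2 * h2

lemma mk_choose_two_mul_succ :
    (mk fun j => ((2 + j).choose 2 * (2 + (j + 1)).choose 2 : ℤ)) * (1 - X) ^ 5 = 3 + 3 * X := by
  have h3 := mk_add_choose_mul_one_sub_pow_eq_one ℤ 3
  have h4 := mk_add_choose_mul_one_sub_pow_eq_one ℤ 4
  have h : (mk fun j => ((2 + j).choose 2 * (2 + (j + 1)).choose 2 : ℤ)) =
      6 * (mk fun j => ((4 + j).choose 4 : ℤ)) - 3 * (mk fun j => ((3 + j).choose 3 : ℤ)) := by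
    ext j
    have h6 (f : ℤ⟦X⟧) : coeff j (6 * f) = 6 * coeff j f := coeff_C_mul j f 6
    have h3 (f : ℤ⟦X⟧) : coeff j (3 * f) = 3 * coeff j f := coeff_C_mul j f 3
    simp only [map_sub, h6, h3, coeff_mk, choose_two_mul_succ]
  rw [h]
  linear_combination 6 * h4 - 3 * (1 - X) * h3

/-- The generating function, by total degree, of the pairs of monomials in two sets of three
variables whose degrees differ by `k`. -/
noncomputable def unbalancedSeries (k : ℕ) : ℤ⟦X⟧ :=
  mk fun m => ∑ x ∈ Finset.HasAntidiagonal.antidiagonal m with x.2 = x.1 + k,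
    ((2 + x.1).choose 2 * (2 + x.2).choose 2 : ℤ)

lemma unbalancedSeries_eq (k : ℕ) :
    unbalancedSeries k = X ^ k * expand 2 two_ne_zero
      (mk fun j => ((2 + j).choose 2 * (2 + (j + k)).choose 2 : ℤ)) := by
  ext m
  rw [coeff_X_pow_mul', unbalancedSeries, coeff_mk, coeff_expand, ← ite_and, coeff_mk]
  split_ifs with h
  · obtain ⟨hk, j, hj⟩ := h
    obtain rfl : m = 2 * j + k := by omega
    have : {x ∈ Finset.HasAntidiagonal.antidiagonal (2 * j + k) | x.2 = x.1 + k} = {(j, j + k)} := by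
      ext ⟨a, b⟩
      simp only [Finset.mem_filter, Finset.HasAntidiagonal.mem_antidiagonal, Finset.mem_singleton,
        Prod.mk.injEq]
      omega
    rw [this, Finset.sum_singleton]
    simp
  · rw [Finset.filter_eq_empty_iff.2, Finset.sum_empty]
    rintro ⟨a, b⟩ hab hk
    simp only [Finset.HasAntidiagonal.mem_antidiagonal] at hab hk
    exact h ⟨by omega, a, by omega⟩

lemma unbalancedSeries_zero_mul :
    unbalancedSeries 0 * (1 - X ^ 2) ^ 5 = 1 + 4 * X ^ 2 + X ^ 4 := by
  have h := congrArg (expand 2 two_ne_zero) mk_choose_two_mul_self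
  simp only [map_mul, map_pow, map_sub, map_add, map_one, expand_X, map_ofNat] at h
  rw [unbalancedSeries_eq]
  simp only [add_zero, pow_zero, one_mul]
  rw [h]
  ring

lemma unbalancedSeries_one_mul :
    unbalancedSeries 1 * (1 - X ^ 2) ^ 5 = 3 * X + 3 * X ^ 3 := by
  have h := congrArg (expand 2 two_ne_zero) mk_choose_two_mul_succ
  simp only [map_mul, map_pow, map_sub, map_add, map_one, expand_X, map_ofNat] at h
  rw [unbalancedSeries_eq]
  linear_combination X * h

lemma series_mul_denominator :
    (mk fun n => ((2 + n).choose 2 : ℤ)) ^ 2 * (unbalancedSeries 0 - unbalancedSeries 1) *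
      ((1 - X ^ 2) ^ 5 * (1 - X) ^ 4) = 1 - X + X ^ 2 := by
  set A : ℤ⟦X⟧ := mk fun n => ((2 + n).choose 2 : ℤ) with hA
  have h2 : A * (1 - X) ^ 3 = 1 := mk_add_choose_mul_one_sub_pow_eq_one ℤ 2
  calc _ = A ^ 2 * (1 - X) ^ 4 * (unbalancedSeries 0 * (1 - X ^ 2) ^ 5 -
        unbalancedSeries 1 * (1 - X ^ 2) ^ 5) := by ring
    _ = (A * (1 - X) ^ 3) ^ 2 * (1 - X + X ^ 2) := by
      rw [unbalancedSeries_zero_mul, unbalancedSeries_one_mul]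
      ring
    _ = _ := by rw [h2, one_pow, one_mul]

end Series

section Count

/-- Positions of the entries of a triple of `2 × 2` matrices. -/
abbrev Entry := Fin 3 × Fin 2 × Fin 2

/-- The bidegree of a coordinate function: its degree, and its weight under the diagonal torus. -/
def bidegree (s : Entry) : ℕ × ℤ := (1, (s.2.1 : ℤ) - (s.2.2 : ℤ))

/-- The exponents of the coordinates at the position `(r, c)` in each of the three matrices. -/
noncomputable def entryPart (d : Entry →₀ ℕ) (r c : Fin 2) : Fin 3 →₀ ℕ :=
  Finsupp.equivFunOnFinite.symm fun i => d (i, r, c)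

/-- Exponents on all coordinates, given position by position. -/
noncomputable def ofEntryParts (f : Fin 2 → Fin 2 → Fin 3 →₀ ℕ) : Entry →₀ ℕ :=
  Finsupp.equivFunOnFinite.symm fun s => f s.2.1 s.2.2 s.1

lemma weight_bidegree (d : Entry →₀ ℕ) :
    Finsupp.weight bidegree d =
      ((Finset.univ.sum (entryPart d 0 0)) + (Finset.univ.sum (entryPart d 1 1)) +
        ((Finset.univ.sum (entryPart d 0 1)) + (Finset.univ.sum (entryPart d 1 0))),
        ((Finset.univ.sum (entryPart d 1 0) : ℕ) : ℤ) - (Finset.univ.sum (entryPart d 0 1) : ℕ)) := by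
  rw [Finsupp.weight_apply, Finsupp.sum_fintype _ _ (by simp)]
  simp only [Fintype.sum_prod_type, Fin.sum_univ_two, Fin.sum_univ_three, bidegree, entryPart]
  ext <;> simp <;> ring

/-- The exponents of bidegree `(n, k)`, split by position and sorted by their partial degrees. -/
def splitExponents (n k : ℕ) : Finset (Σ _ : ℕ × ℕ,
    (Σ _ : ℕ × ℕ, (Fin 3 →₀ ℕ) × (Fin 3 →₀ ℕ)) × (Σ _ : ℕ × ℕ, (Fin 3 →₀ ℕ) × (Fin 3 →₀ ℕ))) :=
  (Finset.HasAntidiagonal.antidiagonal n).sigma fun x =>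
    ((Finset.HasAntidiagonal.antidiagonal x.1).sigma fun y =>
      Finset.univ.finsuppAntidiag y.1 ×ˢ Finset.univ.finsuppAntidiag y.2) ×ˢ
    ({z ∈ Finset.HasAntidiagonal.antidiagonal x.2 | z.2 = z.1 + k}.sigma fun z =>
      Finset.univ.finsuppAntidiag z.1 ×ˢ Finset.univ.finsuppAntidiag z.2)

lemma card_splitExponents (n k : ℕ) :
    ((splitExponents n k).card : ℤ) =
      coeff n ((mk fun n => ((2 + n).choose 2 : ℤ)) ^ 2 * unbalancedSeries k) := by
  have hc (j : ℕ) : ((Finset.univ : Finset (Fin 3)).finsuppAntidiag j).card = (2 + j).choose 2 := by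
    rw [Finset.card_finsuppAntidiag_nat_eq_choose, Finset.card_fin, Nat.add_comm 2 j,
      ← Nat.choose_symm_add]
    congr 1
    omega
  simp only [splitExponents, Finset.card_sigma, Finset.card_product, hc, Nat.cast_sum, Nat.cast_mul,
    coeff_mul, sq, coeff_mk, unbalancedSeries]

lemma ncard_bidegree (n k : ℕ) :
    {d : Entry →₀ ℕ | Finsupp.weight bidegree d = (n, (k : ℤ))}.ncard =
      (splitExponents n k).card := by
  set f : (Σ _ : ℕ × ℕ, (Σ _ : ℕ × ℕ, (Fin 3 →₀ ℕ) × (Fin 3 →₀ ℕ)) ×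
      (Σ _ : ℕ × ℕ, (Fin 3 →₀ ℕ) × (Fin 3 →₀ ℕ))) → (Entry →₀ ℕ) := fun t =>
    ofEntryParts ![![t.2.1.2.1, t.2.2.2.1], ![t.2.2.2.2, t.2.1.2.2]] with hf
  have hfpart (g : Fin 2 → Fin 2 → Fin 3 →₀ ℕ) (r c : Fin 2) :
      entryPart (ofEntryParts g) r c = g r c := by
    ext i
    simp [entryPart, ofEntryParts]
  rw [← Finset.card_image_of_injOn (f := f), ← Set.ncard_coe_finset]
  · congr 1
    ext d
    simp only [Set.mem_ofPred_eq, Finset.coe_image, Set.mem_image, Finset.mem_coe, weight_bidegree,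
      Prod.mk.injEq]
    constructor
    · rintro ⟨h1, h2⟩
      refine ⟨⟨(Finset.univ.sum (entryPart d 0 0) + Finset.univ.sum (entryPart d 1 1),
            Finset.univ.sum (entryPart d 0 1) + Finset.univ.sum (entryPart d 1 0)),
          ⟨⟨(Finset.univ.sum (entryPart d 0 0), Finset.univ.sum (entryPart d 1 1)),
            entryPart d 0 0, entryPart d 1 1⟩,
          ⟨(Finset.univ.sum (entryPart d 0 1), Finset.univ.sum (entryPart d 1 0)),
            entryPart d 0 1, entryPart d 1 0⟩⟩⟩, ?_, ?_⟩
      rotate_left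
      · ext ⟨i, r, c⟩
        fin_cases r <;> fin_cases c <;> simp [hf, ofEntryParts, entryPart]
      · simp only [splitExponents, Finset.mem_sigma, Finset.mem_product, Finset.mem_filter,
          Finset.HasAntidiagonal.mem_antidiagonal, Finset.mem_finsuppAntidiag, Finset.subset_univ,
          and_true]
        simp only [true_and]
        omega
    · rintro ⟨⟨⟨x1, x2⟩, ⟨⟨⟨y1, y2⟩, a, b⟩, ⟨⟨z1, z2⟩, u, v⟩⟩⟩, h, rfl⟩
      simp only [splitExponents, Finset.mem_sigma, Finset.mem_product, Finset.mem_filter,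
        Finset.HasAntidiagonal.mem_antidiagonal, Finset.mem_finsuppAntidiag, Finset.subset_univ,
        and_true] at h
      rw [hf, hfpart, hfpart, hfpart, hfpart]
      change Finset.univ.sum a + Finset.univ.sum b + (Finset.univ.sum u + Finset.univ.sum v) = n ∧
        ((Finset.univ.sum v : ℕ) : ℤ) - (Finset.univ.sum u : ℕ) = k
      omega
  · rintro ⟨⟨x1, x2⟩, ⟨⟨⟨y1, y2⟩, a, b⟩, ⟨⟨z1, z2⟩, u, v⟩⟩⟩ h
      ⟨⟨x1', x2'⟩, ⟨⟨⟨y1', y2'⟩, a', b'⟩, ⟨⟨z1', z2'⟩, u', v'⟩⟩⟩ h' hff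
    have hp (r c) := congrArg (entryPart · r c) hff
    simp only [hf, hfpart] at hp
    obtain rfl : a = a' := hp 0 0
    obtain rfl : b = b' := hp 1 1
    obtain rfl : u = u' := hp 0 1
    obtain rfl : v = v' := hp 1 0
    simp only [splitExponents, Finset.coe_sigma, Set.mem_sigma_iff, Finset.mem_coe,
      Finset.mem_sigma, Finset.mem_product, Finset.mem_filter,
      Finset.HasAntidiagonal.mem_antidiagonal, Finset.mem_finsuppAntidiag, Finset.subset_univ,
      and_true] at h h'
    obtain ⟨-, ⟨rfl, rfl, rfl⟩, ⟨rfl, -⟩, rfl, rfl⟩ := h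
    obtain ⟨-, ⟨rfl, rfl, rfl⟩, ⟨rfl, -⟩, rfl, rfl⟩ := h'
    rfl

end Count

section Derivations

open MvPolynomial

lemma MvPolynomial.IsWeightedHomogeneous.mkDerivation {R σ M : Type*} [CommSemiring R]
    [AddCommMonoid M] {w : σ → M} {δ m : M} {f : σ → MvPolynomial σ R}
    (hf : ∀ s, IsWeightedHomogeneous w (f s) (w s + δ)) {P : MvPolynomial σ R}
    (hP : IsWeightedHomogeneous w P m) :
    IsWeightedHomogeneous w (mkDerivation R f P) (m + δ) := by
  induction hP using IsWeightedHomogeneous.induction_on with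
  | zero => simpa using isWeightedHomogeneous_zero R w _
  | add P Q hP hQ ihP ihQ => simpa using ihP.add ihQ
  | monomial d r hr =>
    rw [mkDerivation_monomial]
    refine (weightedHomogeneousSubmodule R w _).smul_mem r (Submodule.sum_mem _ fun i hi => ?_)
    change IsWeightedHomogeneous w
      (MvPolynomial.monomial (d - Finsupp.single i 1) (d i : R) * f i) _
    rw [← hr, ← Finsupp.weight_sub_single_add (w := w) (Finsupp.mem_support_iff.1 hi), add_assoc]
    exact (isWeightedHomogeneous_monomial w _ _ rfl).mul (hf i)

variable (K : Type*) [Field K]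

/-- The derivation of the coordinate ring of triples of `2 × 2` matrices induced by the
commutator with the matrix unit at the position `(p, q)`. -/
noncomputable def adDerivation (p q : Fin 2) :
    Derivation K (MvPolynomial Entry K) (MvPolynomial Entry K) :=
  mkDerivation K fun s => (if s.2.1 = p then MvPolynomial.X (s.1, q, s.2.2) else 0) -
    (if s.2.2 = q then MvPolynomial.X (s.1, s.2.1, p) else 0)

variable {K}

lemma adDerivation_mem {p q : Fin 2} {n : ℕ} {k : ℤ} {P : MvPolynomial Entry K}
    (hP : P ∈ weightedHomogeneousSubmodule K bidegree (n, k)) :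
    adDerivation K p q P ∈ weightedHomogeneousSubmodule K bidegree (n, k + ((q : ℤ) - (p : ℤ))) := by
  have := IsWeightedHomogeneous.mkDerivation (δ := ((0 : ℕ), ((q : ℤ) - (p : ℤ))))
    (f := fun s => (if s.2.1 = p then MvPolynomial.X (s.1, q, s.2.2) else 0) -
      (if s.2.2 = q then MvPolynomial.X (s.1, s.2.1, p) else 0)) (fun s => ?_) hP
  · simpa [adDerivation] using this
  · refine (weightedHomogeneousSubmodule K bidegree _).sub_mem ?_ ?_
    · split_ifs with h
      · convert isWeightedHomogeneous_X K bidegree (s.1, q, s.2.2) using 1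
        simp [bidegree, h]
      · exact zero_mem _
    · split_ifs with h
      · convert isWeightedHomogeneous_X K bidegree (s.1, s.2.1, p) using 1
        simp [bidegree, h]
      · exact zero_mem _

lemma coeff_adDerivation_commutator (P : MvPolynomial Entry K) (d : Entry →₀ ℕ) :
    MvPolynomial.coeff d (adDerivation K 0 1 (adDerivation K 1 0 P) -
      adDerivation K 1 0 (adDerivation K 0 1 P)) =
      2 * ((Finsupp.weight bidegree d).2 : K) * MvPolynomial.coeff d P := by
  have h : ⁅adDerivation K 0 1, adDerivation K 1 0⁆ =
      mkDerivation K fun s : Entry =>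
        MvPolynomial.C (2 * ((bidegree s).2 : K)) * MvPolynomial.X s := by
    refine derivation_ext fun ⟨i, r, c⟩ => ?_
    rw [Derivation.commutator_apply]
    fin_cases r <;> fin_cases c <;>
      simp [adDerivation, bidegree, mkDerivation_X, map_ofNat MvPolynomial.C 2] <;> ring
  rw [← Derivation.commutator_apply, h]
  induction P using MvPolynomial.induction_on' with
  | add P Q hP hQ => rw [map_add, MvPolynomial.coeff_add, MvPolynomial.coeff_add, hP, hQ, mul_add]
  | monomial u a =>
    have : mkDerivation K (fun s : Entry => MvPolynomial.C (2 * ((bidegree s).2 : K)) *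
        MvPolynomial.X s) (MvPolynomial.monomial u a) =
        MvPolynomial.monomial u (2 * ((Finsupp.weight bidegree u).2 : K) * a) := by
      rw [mkDerivation_monomial, Finsupp.weight_apply, Finsupp.sum, Finsupp.sum, Prod.snd_sum,
        Int.cast_sum, Finset.mul_sum, Finset.sum_mul, map_sum, Finset.smul_sum]
      refine Finset.sum_congr rfl fun i hi => ?_
      have hi' : u - Finsupp.single i 1 + Finsupp.single i 1 = u :=
        tsub_add_cancel_of_le (Finsupp.single_le_iff.2
          (Nat.one_le_iff_ne_zero.2 (Finsupp.mem_support_iff.1 hi)))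
      rw [MvPolynomial.X, C_mul_monomial, smul_eq_mul, monomial_mul, hi', smul_monomial]
      congr 1
      simp
      ring
    rw [this, MvPolynomial.coeff_monomial, MvPolynomial.coeff_monomial]
    split_ifs with hud
    · rw [hud]
    · simp

lemma adDerivation_commutator {n : ℕ} {k : ℤ} {P : MvPolynomial Entry K}
    (hP : P ∈ weightedHomogeneousSubmodule K bidegree (n, k)) :
    adDerivation K 0 1 (adDerivation K 1 0 P) =
      adDerivation K 1 0 (adDerivation K 0 1 P) + (2 * k : K) • P := by
  rw [← sub_eq_iff_eq_add']
  ext d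
  rw [coeff_adDerivation_commutator, MvPolynomial.coeff_smul, smul_eq_mul]
  by_cases hd : MvPolynomial.coeff d P = 0
  · simp [hd]
  · rw [hP hd]

lemma fst_weight_bidegree (d : Entry →₀ ℕ) :
    (Finsupp.weight bidegree d).1 = Finsupp.weight (1 : Entry → ℕ) d := by
  simp [Finsupp.weight_apply, Finsupp.sum, Prod.fst_sum, bidegree]

lemma finite_bidegree (n : ℕ) (k : ℤ) :
    {d : Entry →₀ ℕ | Finsupp.weight bidegree d = (n, k)}.Finite := by
  refine (Finset.finite_toSet (Finset.univ.finsuppAntidiag n)).subset fun d hd => ?_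
  have h := fst_weight_bidegree d
  rw [Set.mem_ofPred_eq] at hd
  rw [hd, Finsupp.weight_apply, Finsupp.sum_fintype _ _ (by simp)] at h
  simp only [Pi.one_apply, smul_eq_mul, mul_one] at h
  simp [Finset.mem_finsuppAntidiag, h]

variable (K) in
/-- Polynomials of a given bidegree, in terms of their coefficients. -/
noncomputable def bidegreeEquivFinsupp (n : ℕ) (k : ℤ) :
    weightedHomogeneousSubmodule K bidegree (n, k) ≃ₗ[K]
      ({d : Entry →₀ ℕ | Finsupp.weight bidegree d = (n, k)} →₀ K) :=
  (LinearEquiv.ofEq _ _ (weightedHomogeneousSubmodule_eq_finsupp_supported K bidegree _)).trans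
    (AddMonoidAlgebra.supportedEquivFinsupp _)

variable (K) in
lemma finrank_weightedHomogeneousSubmodule_bidegree (n : ℕ) (k : ℤ) :
    Module.finrank K (weightedHomogeneousSubmodule K bidegree (n, k)) =
      {d : Entry →₀ ℕ | Finsupp.weight bidegree d = (n, k)}.ncard := by
  have := (finite_bidegree n k).fintype
  rw [(bidegreeEquivFinsupp K n k).finrank_eq, Module.finrank_finsupp_self,
    Set.ncard_eq_toFinset_card', Set.toFinset_card]

instance (n : ℕ) (k : ℤ) : Module.Finite K (weightedHomogeneousSubmodule K bidegree (n, k)) := by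
  have := (finite_bidegree n k).to_subtype
  exact Module.Finite.equiv (bidegreeEquivFinsupp K n k).symm

lemma eq_zero_of_lt_weight {n : ℕ} {k : ℤ} (hk : (n : ℤ) < |k|) {P : MvPolynomial Entry K}
    (hP : P ∈ weightedHomogeneousSubmodule K bidegree (n, k)) : P = 0 := by
  refine IsWeightedHomogeneous.eq_zero_of_no_monomials hP fun d hd => ?_
  rw [weight_bidegree, Prod.mk.injEq] at hd
  rw [lt_abs] at hk
  omega

/-- Every polynomial of weight `1` is in the image of the raising operator. -/
lemma exists_adDerivation_eq [CharZero K] {n : ℕ} {P : MvPolynomial Entry K}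
    (hP : P ∈ weightedHomogeneousSubmodule K bidegree (n, 1)) :
    ∃ Q ∈ weightedHomogeneousSubmodule K bidegree (n, 0), adDerivation K 0 1 Q = P := by
  have hE (k : ℤ) (Q) (hQ : Q ∈ weightedHomogeneousSubmodule K bidegree (n, k)) :
      (adDerivation K 0 1).toLinearMap Q ∈ weightedHomogeneousSubmodule K bidegree (n, k + 1) := by
    simpa using adDerivation_mem (p := 0) (q := 1) hQ
  have hF (k : ℤ) (Q) (hQ : Q ∈ weightedHomogeneousSubmodule K bidegree (n, k)) :
      (adDerivation K 1 0).toLinearMap Q ∈ weightedHomogeneousSubmodule K bidegree (n, k - 1) := by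
    simpa [← sub_eq_add_neg] using adDerivation_mem (p := 1) (q := 0) hQ
  refine exists_raise_eq (V := fun k => weightedHomogeneousSubmodule K bidegree (n, k)) hE hF
    (fun k Q hQ => adDerivation_commutator hQ) one_pos n hP ?_
  refine eq_zero_of_lt_weight ?_ (pow_raise_mem
    (V := fun k => weightedHomogeneousSubmodule K bidegree (n, k)) hE hP n)
  rw [lt_abs]
  omega

/-- A polynomial of weight `0` annihilated by the raising operator is annihilated by the lowering
operator. -/
lemma adDerivation_one_zero_eq_zero [CharZero K] {n : ℕ} {P : MvPolynomial Entry K}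
    (hP : P ∈ weightedHomogeneousSubmodule K bidegree (n, 0)) (hEP : adDerivation K 0 1 P = 0) :
    adDerivation K 1 0 P = 0 := by
  have hE (k : ℤ) (Q) (hQ : Q ∈ weightedHomogeneousSubmodule K bidegree (n, -k)) :
      (adDerivation K 1 0).toLinearMap Q ∈
        weightedHomogeneousSubmodule K bidegree (n, -(k + 1)) := by
    simpa [neg_add, add_comm] using adDerivation_mem (p := 1) (q := 0) hQ
  have hFP : adDerivation K 1 0 P ∈ weightedHomogeneousSubmodule K bidegree (n, -1) := by
    simpa using adDerivation_mem (p := 1) (q := 0) hP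
  refine eq_zero_of_lower_eq_zero (F := (adDerivation K 0 1).toLinearMap)
    (V := fun k => weightedHomogeneousSubmodule K bidegree (n, -k)) hE
    (fun k Q hQ => ?_) one_pos n hFP ?_ ?_
  · have := adDerivation_commutator hQ
    push_cast at this
    change adDerivation K 1 0 (adDerivation K 0 1 Q) =
      adDerivation K 0 1 (adDerivation K 1 0 Q) + (2 * k : K) • Q
    rw [this, add_assoc, ← add_smul]
    simp
  · refine eq_zero_of_lt_weight ?_ (pow_raise_mem
      (V := fun k => weightedHomogeneousSubmodule K bidegree (n, -k)) hE hFP n)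
    rw [lt_abs]
    omega
  · have := adDerivation_commutator hP
    rw [hEP] at this
    simpa using this

variable (K) in
/-- The invariant polynomials of degree `n`, described infinitesimally. -/
noncomputable def highestWeightInvariants (n : ℕ) : Submodule K (MvPolynomial Entry K) :=
  weightedHomogeneousSubmodule K bidegree (n, 0) ⊓ (adDerivation K 0 1).toLinearMap.ker

lemma mem_highestWeightInvariants [CharZero K] {n : ℕ} {P : MvPolynomial Entry K} :
    P ∈ highestWeightInvariants K n ↔
      P.IsHomogeneous n ∧ ∀ p q, p ≠ q → adDerivation K p q P = 0 := by
  constructor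
  · rintro ⟨hP, hE⟩
    refine ⟨fun d hd => ?_, fun p q hpq => ?_⟩
    · rw [← fst_weight_bidegree, hP hd]
    · fin_cases p <;> fin_cases q
      · exact (hpq rfl).elim
      · exact hE
      · exact adDerivation_one_zero_eq_zero hP hE
      · exact (hpq rfl).elim
  · rintro ⟨hP, h⟩
    refine ⟨fun d hd => ?_, h 0 1 (by decide)⟩
    have hc := coeff_adDerivation_commutator P d
    rw [h 0 1 (by decide), h 1 0 (by decide), map_zero, map_zero, sub_zero,
      MvPolynomial.coeff_zero] at hc
    have h1 := hP hd
    rw [← fst_weight_bidegree] at h1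
    refine Prod.ext h1 ?_
    simpa [hd] using hc

lemma finrank_highestWeightInvariants [CharZero K] (n : ℕ) :
    (Module.finrank K (highestWeightInvariants K n) : ℤ) =
      {d : Entry →₀ ℕ | Finsupp.weight bidegree d = (n, 0)}.ncard -
        {d : Entry →₀ ℕ | Finsupp.weight bidegree d = (n, 1)}.ncard := by
  set V := weightedHomogeneousSubmodule K bidegree (n, 0) with hV
  set E := (adDerivation K 0 1).toLinearMap with hE
  have hmap : V.map E = weightedHomogeneousSubmodule K bidegree (n, 1) := by
    refine le_antisymm ?_ fun P hP => ?_
    · rintro _ ⟨P, hP, rfl⟩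
      simpa [hE] using adDerivation_mem (p := 0) (q := 1) hP
    · exact exists_adDerivation_eq hP
  have h := LinearMap.finrank_range_add_finrank_ker (E.domRestrict V)
  rw [LinearMap.range_domRestrict, LinearMap.ker_domRestrict, hmap,
    finrank_weightedHomogeneousSubmodule_bidegree,
    finrank_weightedHomogeneousSubmodule_bidegree] at h
  rw [highestWeightInvariants, ← hV, ← hE, ← Submodule.map_comap_subtype,
    Submodule.finrank_map_subtype_eq]
  omega

end Derivations

section Conjugation

open MvPolynomial Matrix

variable {K : Type*} [Field K]

/-- The entries of a triple of `2 × 2` matrices. -/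
def entries {R : Type*} (M : Fin 3 → Matrix (Fin 2) (Fin 2) R) : Entry → R :=
  fun s => M s.1 s.2.1 s.2.2

/-- The conjugates of a triple of matrices by the one-parameter group of transvections at the
position `(p, q)`, with polynomial entries in the parameter. -/
noncomputable def transvectionOrbit (p q : Fin 2) (M : Fin 3 → Matrix (Fin 2) (Fin 2) K) :
    Entry → Polynomial K :=
  entries fun i => transvection p q Polynomial.X * (M i).map Polynomial.C *
    transvection p q (-Polynomial.X)

lemma derivative_aeval_transvectionOrbit {p q : Fin 2} (hpq : p ≠ q)
    (M : Fin 3 → Matrix (Fin 2) (Fin 2) K) (P : MvPolynomial Entry K) :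
    Polynomial.derivative (MvPolynomial.aeval (transvectionOrbit p q M) P) =
      MvPolynomial.aeval (transvectionOrbit p q M) (adDerivation K p q P) := by
  induction P using MvPolynomial.induction_on with
  | C a => simp
  | add P Q hP hQ => simp only [map_add, hP, hQ]
  | mul_X P s hP =>
    rw [Derivation.leibniz, map_add, map_mul, Polynomial.derivative_mul, hP, smul_eq_mul,
      smul_eq_mul, map_mul, map_mul, add_comm,
      mul_comm (MvPolynomial.aeval _ (adDerivation K p q P))]
    congr 2
    obtain ⟨i, r, c⟩ := s
    rw [adDerivation, mkDerivation_X]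
    fin_cases p <;> fin_cases q <;> first | exact (hpq rfl).elim | skip
    all_goals
      fin_cases r <;> fin_cases c <;>
      simp [transvectionOrbit, entries, transvection, Matrix.mul_apply, Fin.sum_univ_two] <;> ring

lemma eval_aeval_transvectionOrbit (p q : Fin 2)
    (M : Fin 3 → Matrix (Fin 2) (Fin 2) K) (P : MvPolynomial Entry K) (t : K) :
    (MvPolynomial.aeval (transvectionOrbit p q M) P).eval t =
      eval (entries fun i => transvection p q t * M i * transvection p q (-t)) P := by
  have h (Q : MvPolynomial Entry K) (y : Entry → Polynomial K) :
      (MvPolynomial.aeval y Q).eval t = eval (fun s => (y s).eval t) Q := by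
    induction Q using MvPolynomial.induction_on with
    | C a => simp
    | add Q R hQ hR => simp only [map_add, Polynomial.eval_add, hQ, hR]
    | mul_X Q s hQ => simp only [map_mul, Polynomial.eval_mul, hQ, MvPolynomial.aeval_X, eval_X]
  rw [h]
  congr 2 with s
  obtain ⟨i, r, c⟩ := s
  fin_cases p <;> fin_cases q <;> fin_cases r <;> fin_cases c <;>
    simp [transvectionOrbit, entries, transvection, Matrix.mul_apply, Fin.sum_univ_two] <;> ring

lemma forall_eval_transvection_iff [CharZero K] {p q : Fin 2} (hpq : p ≠ q)
    (P : MvPolynomial Entry K) :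
    (∀ (t : K) (M : Fin 3 → Matrix (Fin 2) (Fin 2) K),
      eval (entries fun i => transvection p q t * M i * transvection p q (-t)) P =
        eval (entries M) P) ↔ adDerivation K p q P = 0 := by
  have h0 (M : Fin 3 → Matrix (Fin 2) (Fin 2) K) (Q : MvPolynomial Entry K) :
      (MvPolynomial.aeval (transvectionOrbit p q M) Q).eval 0 = eval (entries M) Q := by
    simp [eval_aeval_transvectionOrbit]
  constructor
  · intro h
    refine MvPolynomial.funext fun x => ?_
    set M : Fin 3 → Matrix (Fin 2) (Fin 2) K := fun i => Matrix.of fun r c => x (i, r, c)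
    have hM : MvPolynomial.aeval (transvectionOrbit p q M) P = Polynomial.C (eval (entries M) P) :=
      Polynomial.funext fun t => by rw [eval_aeval_transvectionOrbit, h, Polynomial.eval_C]
    have := h0 M (adDerivation K p q P)
    rw [← derivative_aeval_transvectionOrbit hpq, hM, Polynomial.derivative_C,
      Polynomial.eval_zero] at this
    rw [map_zero]
    exact this.symm
  · intro h t M
    have hd := derivative_aeval_transvectionOrbit hpq M P
    rw [h, map_zero] at hd
    have hC := Polynomial.eq_C_of_natDegree_eq_zero
      (Polynomial.derivative_eq_zero.1 hd)
    rw [← eval_aeval_transvectionOrbit, ← h0, hC, Polynomial.eval_C, Polynomial.eval_C]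

lemma eval_diagonal_conj {n : ℕ} {P : MvPolynomial Entry K}
    (hP : P ∈ weightedHomogeneousSubmodule K bidegree (n, 0)) {D : Fin 2 → K} (hD : ∀ r, D r ≠ 0)
    (M : Fin 3 → Matrix (Fin 2) (Fin 2) K) :
    eval (entries fun i => diagonal D * M i * (diagonal D)⁻¹) P = eval (entries M) P := by
  have hinv : (diagonal D)⁻¹ = diagonal fun r => (D r)⁻¹ :=
    Matrix.inv_eq_right_inv (by simp [hD])
  have hentry (s : Entry) : entries (fun i => diagonal D * M i * (diagonal D)⁻¹) s =
      (D 1 / D 0) ^ (bidegree s).2 * entries M s := by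
    obtain ⟨i, r, c⟩ := s
    have h0 := hD 0
    have h1 := hD 1
    rw [hinv]
    fin_cases r <;> fin_cases c <;> simp [entries, bidegree] <;> field_simp
  rw [eval_eq', eval_eq']
  refine Finset.sum_congr rfl fun d hd => ?_
  have hd' := hP (mem_support_iff.1 hd)
  simp only [hentry, mul_pow, Finset.prod_mul_distrib]
  have : ∏ s, ((D 1 / D 0) ^ (bidegree s).2) ^ d s = 1 := by
    have hz : D 1 / D 0 ≠ 0 := div_ne_zero (hD 1) (hD 0)
    have hsum : ∑ s, (bidegree s).2 * (d s : ℤ) = 0 := by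
      rw [show (0 : ℤ) = ((n, 0) : ℕ × ℤ).2 from rfl, ← hd', Finsupp.weight_apply,
        Finsupp.sum_fintype _ _ (by simp),
        Prod.snd_sum]
      simp [mul_comm]
    have hprod (S : Finset Entry) : ∏ s ∈ S, ((D 1 / D 0) ^ (bidegree s).2) ^ d s =
        (D 1 / D 0) ^ ∑ s ∈ S, (bidegree s).2 * (d s : ℤ) := by
      induction S using Finset.cons_induction with
      | empty => simp
      | cons s S hs ih =>
        rw [Finset.prod_cons, Finset.sum_cons, ih, zpow_add₀ hz, _root_.zpow_mul,
          _root_.zpow_natCast]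
    rw [hprod, hsum, _root_.zpow_zero]
  rw [this, one_mul]

lemma mem_highestWeightInvariants_iff_conj [CharZero K] {n : ℕ} {P : MvPolynomial Entry K} :
    P ∈ highestWeightInvariants K n ↔ P.IsHomogeneous n ∧
      ∀ G : Matrix (Fin 2) (Fin 2) K, G.det ≠ 0 → ∀ M : Fin 3 → Matrix (Fin 2) (Fin 2) K,
        eval (entries fun i => G * M i * G⁻¹) P = eval (entries M) P := by
  have hinv {p q : Fin 2} (hpq : p ≠ q) (t : K) :
      (transvection p q t)⁻¹ = transvection p q (-t) :=
    Matrix.inv_eq_right_inv (by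
      rw [transvection_mul_transvection_same _ _ hpq, add_neg_cancel, transvection_zero])
  constructor
  · intro hP
    refine ⟨(mem_highestWeightInvariants.1 hP).1, fun G hG => ?_⟩
    refine diagonal_transvection_induction_of_det_ne_zero (fun G =>
      ∀ M : Fin 3 → Matrix (Fin 2) (Fin 2) K,
        eval (entries fun i => G * M i * G⁻¹) P = eval (entries M) P) G hG ?_ ?_ ?_
    · intro D hD M
      rw [det_diagonal, Finset.prod_ne_zero_iff] at hD
      exact eval_diagonal_conj hP.1 (fun r => hD r (Finset.mem_univ r)) M
    · rintro ⟨p, q, hpq, t⟩ M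
      rw [TransvectionStruct.toMatrix, hinv hpq]
      exact (forall_eval_transvection_iff hpq P).2
        ((mem_highestWeightInvariants.1 hP).2 p q hpq) t M
    · intro A B _ _ hA hB M
      rw [← hB M, ← hA fun i => B * M i * B⁻¹]
      simp only [Matrix.mul_inv_rev, Matrix.mul_assoc]
  · rintro ⟨hP, h⟩
    refine mem_highestWeightInvariants.2 ⟨hP, fun p q hpq => ?_⟩
    refine (forall_eval_transvection_iff hpq P).1 fun t M => ?_
    rw [← h (transvection p q t) (by simp [det_transvection_of_ne _ _ hpq]) M, hinv hpq]

end Conjugation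

section Coordinates

open MvPolynomial

/-- In coordinates, the restrictions to the diagonal of `n`-multilinear forms are the homogeneous
polynomials of degree `n`. -/
lemma exists_multilinearMap_iff_exists_isHomogeneous {K U σ : Type} [Field K] [AddCommGroup U]
    [Module K U] [Fintype σ] (e : U ≃ₗ[K] (σ → K)) (n : ℕ) (F : U → K) :
    (∃ m : MultilinearMap K (fun _ : Fin n => U) K, ∀ u, F u = m fun _ => u) ↔
      ∃ P : MvPolynomial σ K, P.IsHomogeneous n ∧ ∀ u, F u = eval (e u) P := by
  classical
  constructor
  · rintro ⟨m, hm⟩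
    set b := Module.Basis.ofEquivFun e
    refine ⟨∑ f : Fin n → σ, MvPolynomial.C (m fun i => b (f i)) * ∏ i, MvPolynomial.X (f i),
      IsHomogeneous.sum _ _ _ fun f _ => ?_, fun u => ?_⟩
    · have h := IsHomogeneous.prod Finset.univ (fun i => MvPolynomial.X (R := K) (f i))
        (fun _ => 1) fun i _ => isHomogeneous_X K (f i)
      simpa using h.C_mul (m fun i => b (f i))
    · have hu : (fun _ : Fin n => u) = fun _ => ∑ s, e u s • b s := by
        funext
        simpa [b] using (b.sum_equivFun u).symm
      rw [hm, hu, MultilinearMap.map_sum]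
      simp [MultilinearMap.map_smul_univ, mul_comm]
  · rintro ⟨P, hP, hF⟩
    set act : Unit → U → U := fun _ u => u
    suffices h : F ∈ invariantPolynomials K act n from h.1
    have hsum : F = ∑ d ∈ P.support, P.coeff d • fun u => ∏ s, e u s ^ d s := by
      funext u
      rw [hF, eval_eq']
      simp
    rw [hsum]
    refine Submodule.sum_mem _ fun d hd => Submodule.smul_mem _ _ ⟨?_, fun _ _ => rfl⟩
    have hd' : (Finsupp.toMultiset d).toList.length = n := by
      rw [Multiset.length_toList, Finsupp.card_toMultiset, ← hP (mem_support_iff.1 hd),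
        Finsupp.weight_apply]
      simp only [Pi.one_apply, smul_eq_mul, mul_one]
      rfl
    subst hd'
    refine ⟨(MultilinearMap.mkPiAlgebra K (Fin _) K).compLinearMap fun i =>
      LinearMap.proj ((Finsupp.toMultiset d).toList.get i) ∘ₗ e.toLinearMap, fun u => ?_⟩
    simp only [MultilinearMap.compLinearMap_apply, MultilinearMap.mkPiAlgebra_apply,
      LinearMap.comp_apply, LinearMap.proj_apply, LinearEquiv.coe_coe]
    have hlist := List.ofFn_getElem_eq_map (Finsupp.toMultiset d).toList (e u)
    rw [← List.prod_ofFn]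
    refine Eq.trans ?_ (congrArg List.prod hlist).symm
    rw [← Multiset.prod_coe, ← Multiset.map_coe, Multiset.coe_toList,
      Finset.prod_multiset_map_count, Finsupp.toFinset_toMultiset]
    simp only [Finsupp.count_toMultiset]
    exact (Finsupp.prod_fintype d (fun s k => e u s ^ k) fun s => pow_zero _).symm

variable {K W : Type} [Field K] [AddCommGroup W] [Module K W]

/-- The coordinates of a triple of endomorphisms with respect to a basis. -/
noncomputable def entriesEquiv (b : Module.Basis (Fin 2) K W) :
    (Fin 3 → W →ₗ[K] W) ≃ₗ[K] (Entry → K) where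
  toFun u := entries fun i => LinearMap.toMatrix b b (u i)
  invFun x i := Matrix.toLin b b (Matrix.of fun r c => x (i, r, c))
  map_add' u v := by ext; simp [entries]
  map_smul' c u := by ext; simp [entries]
  left_inv u := by
    funext i
    exact Matrix.toLin_toMatrix b b (u i)
  right_inv x := by
    ext s
    simp [entries]

lemma conjAction_invariant_iff (b : Module.Basis (Fin 2) K W) (P : MvPolynomial Entry K) :
    (∀ g u, eval (entriesEquiv b (conjAction K W 3 g u)) P = eval (entriesEquiv b u) P) ↔
      ∀ G : Matrix (Fin 2) (Fin 2) K, G.det ≠ 0 → ∀ M : Fin 3 → Matrix (Fin 2) (Fin 2) K,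
        eval (entries fun i => G * M i * G⁻¹) P = eval (entries M) P := by
  have hconj (g : W ≃ₗ[K] W) (u : Fin 3 → W →ₗ[K] W) :
      entriesEquiv b (conjAction K W 3 g u) = entries fun i =>
        LinearMap.toMatrix b b g.toLinearMap * LinearMap.toMatrix b b (u i) *
          (LinearMap.toMatrix b b g.toLinearMap)⁻¹ := by
    have hinv : (LinearMap.toMatrix b b g.toLinearMap)⁻¹ =
        LinearMap.toMatrix b b g.symm.toLinearMap :=
      Matrix.inv_eq_right_inv (by rw [← LinearMap.toMatrix_comp]; simp)
    simp only [hinv, ← LinearMap.toMatrix_comp b b b, LinearMap.comp_assoc]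
    rfl
  constructor
  · intro h G hG M
    have hG' : IsUnit (LinearMap.toMatrix b b (Matrix.toLin b b G)).det := by simpa using hG
    have := h (LinearEquiv.ofIsUnitDet hG') fun i => Matrix.toLin b b (M i)
    rw [hconj] at this
    simpa [entriesEquiv] using this
  · intro h g u
    rw [hconj]
    exact h _ (g.isUnit_det b b).ne_zero _

lemma finrank_invariantPolynomials_conjAction [CharZero K] (hW : Module.finrank K W = 2) (n : ℕ) :
    Module.finrank K (invariantPolynomials K (conjAction K W 3) n) =
      Module.finrank K (highestWeightInvariants K n) := by
  have : Module.Finite K W := Module.finite_of_finrank_pos (by omega)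
  have b := Module.finBasisOfFinrankEq K W hW
  let Φ : MvPolynomial Entry K →ₗ[K] (Fin 3 → W →ₗ[K] W) → K :=
    LinearMap.pi fun u => (MvPolynomial.aeval (entriesEquiv b u)).toLinearMap
  have hΦ (P) (u) : Φ P u = eval (entriesEquiv b u) P := rfl
  have hinj : Function.Injective Φ := fun P Q hPQ => MvPolynomial.funext fun x => by
    simpa [hΦ] using congrFun hPQ ((entriesEquiv b).symm x)
  have hmap : invariantPolynomials K (conjAction K W 3) n =
      (highestWeightInvariants K n).map Φ := by
    ext F
    rw [Submodule.mem_map]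
    constructor
    · rintro ⟨hm, hF⟩
      obtain ⟨P, hP, hFP⟩ :=
        (exists_multilinearMap_iff_exists_isHomogeneous (entriesEquiv b) n F).1 hm
      simp only [hFP] at hF
      exact ⟨P, mem_highestWeightInvariants_iff_conj.2 ⟨hP, (conjAction_invariant_iff b P).1 hF⟩,
        funext fun u => (hFP u).symm⟩
    · rintro ⟨P, hP, rfl⟩
      obtain ⟨hP, h⟩ := mem_highestWeightInvariants_iff_conj.1 hP
      exact ⟨(exists_multilinearMap_iff_exists_isHomogeneous (entriesEquiv b) n _).2
        ⟨P, hP, fun u => rfl⟩, (conjAction_invariant_iff b P).2 h⟩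
  rw [hmap]
  exact (Submodule.equivMapOfInjective Φ hinj _).finrank_eq.symm

end Coordinates

/-- For `dim W = 2` and `k = 3` (triples of endomorphisms), the Hilbert series of the
invariant ring for simultaneous conjugation is `(1 − x + x²)/((1−x²)⁵(1−x)⁴)`; stated by
multiplying both sides with the denominator, which is invertible in `ℤ[[x]]`. -/
theorem stmt19 (K : Type) [Field K] [CharZero K] (W : Type) [AddCommGroup W] [Module K W]
    (hW : Module.finrank K W = 2) :
    (PowerSeries.mk fun n =>
        (Module.finrank K (invariantPolynomials K (conjAction K W 3) n) : ℤ)) *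
      ((1 - X ^ 2) ^ 5 * (1 - X) ^ 4) = 1 - X + X ^ 2 := by
  have h : (PowerSeries.mk fun n =>
      (Module.finrank K (invariantPolynomials K (conjAction K W 3) n) : ℤ)) =
      (mk fun n => ((2 + n).choose 2 : ℤ)) ^ 2 * (unbalancedSeries 0 - unbalancedSeries 1) := by
    ext n
    have h0 := ncard_bidegree n 0
    have h1 := ncard_bidegree n 1
    rw [Nat.cast_zero] at h0
    rw [Nat.cast_one] at h1
    rw [coeff_mk, finrank_invariantPolynomials_conjAction hW, finrank_highestWeightInvariants, h0,
      h1, card_splitExponents, card_splitExponents, mul_sub, map_sub]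
  rw [h, series_mul_denominator]
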